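/- arXiv:1910.02432 — 3 statements merged into one kernel-verified Lean document; each statement's English description precedes it below -/
import Mathlib

section
/- Let A, B, C be three affinely independent points in ℝ² forming an acute-angled triangle (each of the angles ∠A, ∠B, ∠C is strictly less than π/2), and let K be the convex hull of {A, B, C}. Let F be the orthogonal projection of A onto the line through B and C. Then F ∈ frontier K and F is A-critical for K. -/
open scoped RealInnerProductSpace
open EuclideanGeometry Real

/-- `P` is an `O`-critical point of a convex set `K`: a boundary point distinct from `O` such
that the affine hyperplane through `P` orthogonal to `OP` supports `K`. -/
def IsCriticalPoint (K : Set (EuclideanSpace ℝ (Fin 2)))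
    (O P : EuclideanSpace ℝ (Fin 2)) : Prop :=
  P ∈ frontier K ∧ P ≠ O ∧ ∀ X ∈ K, 0 ≤ ⟪O - P, X - P⟫

theorem mem_frontier_of_forall_inner_nonneg {E : Type*} [NormedAddCommGroup E]
    [InnerProductSpace ℝ E] {K : Set E} {P n : E} (hP : P ∈ K) (hn : n ≠ 0)
    (h : ∀ X ∈ K, 0 ≤ ⟪n, X - P⟫) : P ∈ frontier K := by
  refine ⟨subset_closure hP, fun hint => ?_⟩
  have hcont : Filter.Tendsto (fun t : ℝ => P - t • n) (nhdsWithin 0 (Set.Ioi 0)) (nhds P) := by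
    have : Continuous fun t : ℝ => P - t • n := by fun_prop
    simpa using (this.tendsto 0).mono_left nhdsWithin_le_nhds
  obtain ⟨t, htK, ht⟩ := ((hcont.eventually (mem_interior_iff_mem_nhds.mp hint)).and
    self_mem_nhdsWithin).exists
  have h0 := h _ htK
  have hpos : 0 < t * ⟪n, n⟫ := mul_pos ht (real_inner_self_pos.mpr hn)
  simp only [sub_sub_cancel_left, inner_neg_right, real_inner_smul_right] at h0
  linarith

theorem InnerProductGeometry.inner_pos_of_angle_lt_pi_div_two {E : Type*} [NormedAddCommGroup E]
    [InnerProductSpace ℝ E] {x y : E} (h : InnerProductGeometry.angle x y < π / 2) :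
    0 < ⟪x, y⟫ := by
  have h' := Real.arccos_lt_pi_div_two.mp h
  by_contra! hle
  exact absurd h' (not_lt.mpr (div_nonpos_of_nonpos_of_nonneg hle (by positivity)))

/-- The foot of the altitude from `A` lies on the side `BC` when the angles at `B` and `C`
are acute. -/
theorem EuclideanGeometry.orthogonalProjection_mem_segment {E : Type*} [NormedAddCommGroup E]
    [InnerProductSpace ℝ E] {A B C : E} (hB : ∠ A B C < π / 2) (hC : ∠ B C A < π / 2) :
    (orthogonalProjection (affineSpan ℝ {B, C}) A : E) ∈ segment ℝ B C := by
  have hBpos := InnerProductGeometry.inner_pos_of_angle_lt_pi_div_two hB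
  have hCpos := InnerProductGeometry.inner_pos_of_angle_lt_pi_div_two hC
  obtain ⟨t, ht⟩ := mem_affineSpan_pair_iff_exists_lineMap_eq.mp
    (orthogonalProjection_mem (s := affineSpan ℝ {B, C}) A)
  have horth : ⟪C - B, A - (orthogonalProjection (affineSpan ℝ {B, C}) A : E)⟫ = 0 :=
    vsub_orthogonalProjection_mem_direction_orthogonal (affineSpan ℝ {B, C}) A (C - B)
      (AffineSubspace.vsub_mem_direction (right_mem_affineSpan_pair ℝ B C)
        (left_mem_affineSpan_pair ℝ B C))
  rw [← ht] at horth ⊢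
  rw [AffineMap.lineMap_apply_module'] at horth ⊢
  have e1 : A - (t • (C - B) + B) = (A - B) - t • (C - B) := by abel
  have e2 : A - C = (A - B) - (C - B) := by abel
  have e3 : B - C = -(C - B) := by abel
  simp only [vsub_eq_sub] at hBpos hCpos
  rw [e1, inner_sub_right, real_inner_smul_right] at horth
  rw [e2, e3, inner_neg_left, inner_sub_right] at hCpos
  rw [real_inner_comm] at hBpos
  have hnn : 0 ≤ ⟪C - B, C - B⟫ := real_inner_self_nonneg
  have ht0 : 0 ≤ t := by
    by_contra! h
    nlinarith
  have ht1 : t ≤ 1 := by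
    by_contra! h
    nlinarith
  exact ⟨1 - t, t, by linarith, ht0, by ring, by module⟩

theorem foot_of_altitude_is_critical
    (A B C : EuclideanSpace ℝ (Fin 2)) (hind : AffineIndependent ℝ ![A, B, C])
    (hA : ∠ B A C < π / 2) (hB : ∠ A B C < π / 2) (hC : ∠ B C A < π / 2)
    (K : Set (EuclideanSpace ℝ (Fin 2))) (hK : K = convexHull ℝ {A, B, C})
    (F : EuclideanSpace ℝ (Fin 2))
    (hF : F = (EuclideanGeometry.orthogonalProjection (affineSpan ℝ {B, C}) A :
      EuclideanSpace ℝ (Fin 2))) :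
    F ∈ frontier K ∧ IsCriticalPoint K A F := by
  have hline : F ∈ affineSpan ℝ {B, C} := hF ▸ orthogonalProjection_mem A
  have hFA : F ≠ A := by
    rintro rfl
    exact affineIndependent_iff_not_collinear_set.mp hind
      (collinear_insert_of_mem_affineSpan_pair hline)
  have hFK : F ∈ K := by
    rw [hK]
    have hseg : F ∈ segment ℝ B C := hF ▸ orthogonalProjection_mem_segment hB hC
    rw [← convexHull_pair] at hseg
    exact convexHull_mono (Set.subset_insert _ _) hseg
  have horth : ∀ X ∈ affineSpan ℝ {B, C}, ⟪A - F, X - F⟫ = 0 := by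
    intro X hX
    rw [real_inner_comm]
    have := vsub_orthogonalProjection_mem_direction_orthogonal (affineSpan ℝ {B, C}) A (X - F)
      (AffineSubspace.vsub_mem_direction hX hline)
    rwa [← hF] at this
  have hsupp : ∀ X ∈ K, 0 ≤ ⟪A - F, X - F⟫ := by
    have hconv : Convex ℝ {X | 0 ≤ ⟪A - F, X - F⟫} := by
      simp only [inner_sub_right (A - F), sub_nonneg]
      exact convex_halfSpace_ge (innerₛₗ ℝ (A - F)).isLinear _
    rw [hK]
    refine fun X hX => convexHull_min ?_ hconv hX
    rintro X (rfl | rfl | rfl)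
    · exact real_inner_self_nonneg
    · exact (horth _ (left_mem_affineSpan_pair ℝ _ _)).ge
    · exact (horth _ (right_mem_affineSpan_pair ℝ _ _)).ge
  have hfr : F ∈ frontier K :=
    mem_frontier_of_forall_inner_nonneg hFK (sub_ne_zero.mpr hFA.symm) hsupp
  exact ⟨hfr, hfr, hFA, hsupp⟩
end

section
/- Let K ⊆ ℝ² be a compact convex set, let O ∈ frontier K, let r > 0, and let P ∈ frontier K with dist(O, P) = r and P ≠ O. Suppose there is an open neighborhood U of P such that frontier K ∩ U ⊆ Metric.sphere O r (the boundary of K coincides with the circle of radius r around O near P). Then P is O-critical. -/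
open scoped RealInnerProductSpace

/-- A point `Y` of the open half-space beyond the tangent hyperplane at `P` of the sphere around
`O` through `P` lies outside that sphere. -/
theorem dist_lt_dist_of_inner_sub_pos {E : Type*} [NormedAddCommGroup E] [InnerProductSpace ℝ E]
    {O P Y : E} (h : 0 < ⟪P - O, Y - P⟫) : dist P O < dist Y O := by
  rw [dist_eq_norm, dist_eq_norm]
  refine lt_of_pow_lt_pow_left₀ 2 (norm_nonneg _) ?_
  rw [← sub_add_sub_cancel Y P O, add_comm (Y - P), norm_add_sq_real]
  nlinarith [sq_nonneg ‖Y - P‖]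

/-- If the boundary of a closed convex set coincides near `P` with a sphere around a point `O` of
the set, then the tangent hyperplane of the sphere at `P` supports the set. -/
theorem inner_sub_nonneg_of_frontier_locally_spherical {E : Type*} [NormedAddCommGroup E]
    [InnerProductSpace ℝ E] {K U : Set E} {O P : E} (hKcl : IsClosed K) (hKc : Convex ℝ K)
    (hO : O ∈ K) (hP : P ∈ frontier K) (hPO : P ≠ O) (hU : U ∈ nhds P)
    (hloc : frontier K ∩ U ⊆ Metric.sphere O (dist P O)) {X : E} (hX : X ∈ K) :
    0 ≤ ⟪O - P, X - P⟫ := by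
  have hPK : P ∈ K := hKcl.frontier_subset hP
  by_contra! hneg
  have hpos : 0 < ⟪P - O, X - P⟫ := by
    rw [← neg_sub O P, inner_neg_left]
    linarith
  have hd : 0 < ‖P - O‖ := norm_pos_iff.2 (sub_ne_zero.2 hPO)
  obtain ⟨ε, hε, hball⟩ := Metric.mem_nhds_iff.1 hU
  have hsmall (v : E) : ∃ t : ℝ, 0 < t ∧ t < 1 ∧ P + t • v ∈ Metric.ball P ε := by
    have hlim : Filter.Tendsto (fun t : ℝ => P + t • v) (nhdsWithin 0 (Set.Ioi 0)) (nhds P) := by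
      have hc : Continuous fun t : ℝ => P + t • v := by fun_prop
      simpa using (hc.tendsto 0).mono_left nhdsWithin_le_nhds
    have hev := (hlim.eventually (Metric.ball_mem_nhds P hε)).and
      (Ioo_mem_nhdsGT (zero_lt_one' ℝ))
    obtain ⟨t, hb, h0, h1⟩ := hev.exists
    exact ⟨t, h0, h1, hb⟩
  set H : Set E := {Y | 0 < ⟪P - O, Y⟫ - ⟪P - O, P⟫} ∩ Metric.ball P ε
  have hHconv : Convex ℝ H := by
    refine Convex.inter ?_ (convex_ball P ε)
    simp only [sub_pos]
    exact convex_halfSpace_gt (innerₛₗ ℝ (P - O)).isLinear _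
  have hHfr : ¬ (H ∩ frontier K).Nonempty := by
    rintro ⟨Y, ⟨hY, hYb⟩, hYf⟩
    have hlt := dist_lt_dist_of_inner_sub_pos (O := O) (P := P) (Y := Y)
      (by rw [inner_sub_right]; exact hY)
    exact hlt.ne' (hloc ⟨hYf, hball hYb⟩)
  obtain ⟨t, ht0, ht1, htb⟩ := hsmall (X - P)
  obtain ⟨s, hs0, -, hsb⟩ := hsmall (P - O)
  obtain ⟨q, hq0, hq1, hqb⟩ := hsmall (O - P)
  have hXH : P + t • (X - P) ∈ H := by
    refine ⟨?_, htb⟩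
    simp only [Set.mem_ofPred_eq, inner_add_right, inner_smul_right, add_sub_cancel_left]
    positivity
  have hZH : P + s • (P - O) ∈ H := by
    refine ⟨?_, hsb⟩
    simp only [Set.mem_ofPred_eq, inner_add_right, inner_smul_right, add_sub_cancel_left,
      real_inner_self_eq_norm_sq]
    positivity
  have hZK : P + s • (P - O) ∈ K := by
    by_contra hZ
    have mem_int {Y : E} (hY : Y ∈ H) (hYK : Y ∈ K) : Y ∈ interior K := by
      by_contra hYi
      exact hHfr ⟨Y, hY, subset_closure hYK, hYi⟩
    obtain ⟨Y, -, hYi, hYc⟩ := hHconv.isPreconnected (interior K) Kᶜ isOpen_interior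
      hKcl.isOpen_compl (fun Y hY => (em (Y ∈ K)).imp_left (mem_int hY))
      ⟨_, hXH, mem_int hXH (hKc.add_smul_sub_mem hPK hX ⟨ht0.le, ht1.le⟩)⟩ ⟨_, hZH, hZ⟩
    exact hYc (interior_subset hYi)
  have hQint : P + q • (O - P) ∈ interior K := by
    by_contra hQ
    have hQK := hKc.add_smul_sub_mem hPK hO ⟨hq0.le, hq1.le⟩
    have hQs := hloc ⟨⟨subset_closure hQK, hQ⟩, hball hqb⟩
    have hQe : P + q • (O - P) - O = (1 - q) • (P - O) := by module
    rw [Metric.mem_sphere, dist_eq_norm, dist_eq_norm, hQe, norm_smul, Real.norm_eq_abs,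
      abs_of_pos (by linarith)] at hQs
    nlinarith
  refine hP.2 (hKc.openSegment_interior_self_subset_interior hQint hZK ?_)
  refine ⟨s / (q + s), q / (q + s), by positivity, by positivity, by field_simp; ring, ?_⟩
  match_scalars <;> field_simp <;> ring

theorem critical_of_boundary_locally_spherical
    (K : Set (EuclideanSpace ℝ (Fin 2))) (hK : IsCompact K) (hKc : Convex ℝ K)
    (O : EuclideanSpace ℝ (Fin 2)) (hO : O ∈ frontier K)
    (r : ℝ) (hr : 0 < r)
    (P : EuclideanSpace ℝ (Fin 2)) (hP : P ∈ frontier K)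
    (hPd : dist O P = r) (hPO : P ≠ O)
    (U : Set (EuclideanSpace ℝ (Fin 2))) (hU : IsOpen U) (hPU : P ∈ U)
    (hloc : frontier K ∩ U ⊆ Metric.sphere O r) :
    IsCriticalPoint K O P := by
  subst hPd
  rw [dist_comm] at hloc
  exact ⟨hP, hPO, fun X hX => inner_sub_nonneg_of_frontier_locally_spherical hK.isClosed hKc
    (hK.isClosed.frontier_subset hO) hP hPO (hU.mem_nhds hPU) hloc hX⟩
end

section
/- Let K ⊆ ℝ² be a compact convex set, let O ∈ frontier K, and let r > 0. Let γ be a connected component of frontier K ∩ Metric.closedBall O r that does not contain O, and suppose C ∈ γ satisfies dist(O, C) ≤ dist(O, X) for all X ∈ γ (C is a nearest point of γ to O) and dist(O, C) < r. Then C is O-critical; in particular the line through C orthogonal to the segment OC supports K. -/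
open scoped RealInnerProductSpace

open Set Filter Topology

section CriticalPoints

variable {E : Type*} [NormedAddCommGroup E]

/-- The gauge of a convex set based at an interior point `X`, which gives the radial projection
from `X` onto the frontier. -/
lemma exists_radial_gauge [NormedSpace ℝ E] {K : Set E} (hKc : Convex ℝ K) {X : E}
    (hX : X ∈ interior K) :
    ∃ g : E → ℝ, Continuous g ∧ (∀ Y ∈ K, g Y ≤ 1) ∧ (∀ Y ∈ frontier K, g Y = 1) ∧
      ∀ Y, 0 < g Y → X + (g Y)⁻¹ • (Y - X) ∈ frontier K := by
  set A : Set E := (fun z => X + z) ⁻¹' K with hA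
  have hAc : Convex ℝ A := hKc.translate_preimage_right X
  have hA0 : A ∈ 𝓝 (0 : E) := by
    have hcont : ContinuousAt (fun z : E => X + z) 0 := by fun_prop
    refine hcont.preimage_mem_nhds ?_
    simpa using mem_interior_iff_mem_nhds.mp hX
  have hfr : ∀ z, gauge A z = 1 ↔ X + z ∈ frontier K := by
    intro z
    rw [gauge_eq_one_iff_mem_frontier hAc hA0]
    have h := (Homeomorph.addLeft X).preimage_frontier K
    have h' : frontier A = (fun z => X + z) ⁻¹' frontier K := h.symm
    rw [h', mem_preimage]
  refine ⟨fun Y => gauge A (Y - X), (continuous_gauge hAc hA0).comp (by fun_prop), ?_, ?_, ?_⟩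
  · intro Y hY
    exact gauge_le_one_of_mem (by simpa [hA] using hY)
  · intro Y hY
    exact (hfr _).2 (by simpa using hY)
  · intro Y hY
    rw [← hfr, gauge_smul_of_nonneg (inv_nonneg.2 hY.le), smul_eq_mul, inv_mul_cancel₀ hY.ne']

/-- If `C` is not critical because of an interior point `X`, then the frontier contains a
connected set through `C` within distance `dist O C` of `O` which has a point strictly closer
to `O`. -/
lemma exists_preconnected_subset_frontier_closer [InnerProductSpace ℝ E] {K : Set E}
    (hKc : Convex ℝ K) {O C X : E} (hO : O ∈ K) (hCK : C ∈ K) (hC : C ∈ frontier K)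
    (hCO : C ≠ O) (hX : X ∈ interior K) (hneg : ⟪O - C, X - C⟫ < 0) :
    ∃ T ⊆ frontier K ∩ Metric.closedBall O (dist O C), IsPreconnected T ∧ C ∈ T ∧
      ∃ P ∈ T, dist O P < dist O C := by
  obtain ⟨g, hg, hg1, hgf, hgp⟩ := exists_radial_gauge hKc hX
  set Y : ℝ → E := fun t => C + t • (O - C) with hY
  have hYc : Continuous Y := by fun_prop
  have hY0 : Y 0 = C := by simp [hY]
  have hYK : ∀ t ∈ Icc (0 : ℝ) 1, Y t ∈ K := fun t ht =>
    hKc.add_smul_sub_mem hCK hO ht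
  have hgY0 : g (Y 0) = 1 := by rw [hY0, hgf C hC]
  have hgY : ContinuousAt (fun t => g (Y t)) 0 := (hg.comp hYc).continuousAt
  have hpos : ∀ᶠ t in 𝓝 (0 : ℝ), 0 < g (Y t) :=
    hgY.eventually (lt_mem_nhds (hgY0.symm ▸ one_pos : 0 < g (Y 0)))
  have hsmall : ∀ᶠ t in 𝓝 (0 : ℝ), ((g (Y t))⁻¹ - 1) * ‖Y t - X‖ ^ 2 <
      2 * (1 - t) * (-⟪O - C, X - C⟫) := by
    have hinv : ContinuousAt (fun t => (g (Y t))⁻¹) 0 := hgY.inv₀ (by rw [hgY0]; exact one_ne_zero)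
    have hl : ContinuousAt (fun t => ((g (Y t))⁻¹ - 1) * ‖Y t - X‖ ^ 2) 0 :=
      (hinv.sub continuousAt_const).mul (by fun_prop)
    have hr : ContinuousAt (fun t : ℝ => 2 * (1 - t) * (-⟪O - C, X - C⟫)) 0 := by fun_prop
    refine hl.eventually_lt hr ?_
    rw [hgY0]
    simp only [inv_one, sub_self, zero_mul, sub_zero]
    linarith
  obtain ⟨ε, hε, hball⟩ := Metric.eventually_nhds_iff.mp (hpos.and hsmall)
  set δ : ℝ := min (ε / 2) 1 with hδ
  have hδ0 : 0 < δ := lt_min (by linarith) one_pos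
  have hδ1 : δ ≤ 1 := min_le_right _ _
  have hIcc : ∀ t ∈ Icc 0 δ, 0 < g (Y t) ∧ ((g (Y t))⁻¹ - 1) * ‖Y t - X‖ ^ 2 <
      2 * (1 - t) * (-⟪O - C, X - C⟫) := by
    intro t ht
    apply hball
    have hle : δ ≤ ε / 2 := min_le_left _ _
    rw [Real.dist_eq, sub_zero, abs_of_nonneg ht.1]
    linarith [ht.2]
  set P : ℝ → E := fun t => X + (g (Y t))⁻¹ • (Y t - X) with hP
  have hP0 : P 0 = C := by simp [hP, hY0, hgf C hC]
  have hPc : ContinuousOn P (Icc 0 δ) := by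
    have hi : ContinuousOn (fun t => (g (Y t))⁻¹) (Icc 0 δ) :=
      (hg.comp hYc).continuousOn.inv₀ fun t ht => (hIcc t ht).1.ne'
    exact continuousOn_const.add (hi.smul (by fun_prop))
  have hdist : ∀ t ∈ Icc 0 δ, dist O (P t) ≤ (1 - t) * dist O C := by
    intro t ht
    obtain ⟨hgt, hst⟩ := hIcc t ht
    have ht1 : 0 ≤ 1 - t := by linarith [ht.2]
    have hs : 0 ≤ (g (Y t))⁻¹ - 1 :=
      sub_nonneg.2 ((one_le_inv₀ hgt).2 (hg1 _ (hYK t ⟨ht.1, ht.2.trans hδ1⟩)))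
    set s := (g (Y t))⁻¹ - 1 with hsdef
    have hvec : O - P t = (1 - t) • (O - C) - s • (Y t - X) := by
      simp only [hP, hY, hsdef]
      module
    have hinner : ⟪O - C, Y t - X⟫ = t * ‖O - C‖ ^ 2 - ⟪O - C, X - C⟫ := by
      have : Y t - X = t • (O - C) - (X - C) := by simp only [hY]; module
      rw [this, inner_sub_right, inner_smul_right, real_inner_self_eq_norm_sq]
    rw [dist_eq_norm, dist_eq_norm]
    refine le_of_sq_le_sq ?_ (by positivity)
    rw [hvec, norm_sub_sq_real, norm_smul, norm_smul, inner_smul_left, inner_smul_right, hinner]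
    simp only [Real.norm_eq_abs, mul_pow, sq_abs, conj_trivial]
    have h1 := mul_le_mul_of_nonneg_left hst.le hs
    have h2 : 0 ≤ (1 - t) * s * (t * ‖O - C‖ ^ 2) :=
      mul_nonneg (mul_nonneg ht1 hs) (mul_nonneg ht.1 (sq_nonneg _))
    nlinarith
  have hd : 0 < dist O C := dist_pos.2 hCO.symm
  refine ⟨P '' Icc 0 δ, ?_, isPreconnected_Icc.image P hPc, ⟨0, ⟨le_rfl, hδ0.le⟩, hP0⟩,
    P δ, mem_image_of_mem P ⟨hδ0.le, le_rfl⟩, ?_⟩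
  · rintro _ ⟨t, ht, rfl⟩
    refine ⟨hgp _ (hIcc t ht).1, ?_⟩
    rw [Metric.mem_closedBall, dist_comm]
    nlinarith [hdist t ht, ht.1]
  · nlinarith [hdist δ ⟨hδ0.le, le_rfl⟩]

/-- If a component of `frontier K ∩ closedBall O r` misses `O ∈ frontier K`, then the closed
convex set `K` has nonempty interior. -/
lemma interior_nonempty_of_notMem_component [NormedSpace ℝ E] {K : Set E} (hK : IsClosed K)
    (hKc : Convex ℝ K) {O C : E} {r : ℝ} (hr : 0 ≤ r) (hO : O ∈ frontier K)
    (hC : C ∈ frontier K ∩ Metric.closedBall O r)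
    (hOC : O ∉ connectedComponentIn (frontier K ∩ Metric.closedBall O r) C) :
    (interior K).Nonempty := by
  by_contra hne
  refine hOC ?_
  have hfr : frontier K = K := by
    rw [hK.frontier_eq, not_nonempty_iff_eq_empty.1 hne, sdiff_empty]
  have hconv : Convex ℝ (frontier K ∩ Metric.closedBall O r) := by
    rw [hfr]
    exact hKc.inter (convex_closedBall O r)
  exact hconv.isPreconnected.subset_connectedComponentIn hC Subset.rfl
    ⟨hO, Metric.mem_closedBall_self hr⟩

end CriticalPoints

theorem nearest_point_of_component_is_critical
    (K : Set (EuclideanSpace ℝ (Fin 2))) (hK : IsCompact K) (hKc : Convex ℝ K)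
    (O : EuclideanSpace ℝ (Fin 2)) (hO : O ∈ frontier K)
    (r : ℝ) (hr : 0 < r)
    (γ : Set (EuclideanSpace ℝ (Fin 2))) (C : EuclideanSpace ℝ (Fin 2))
    (hCγ : C ∈ γ)
    (hγ : γ = connectedComponentIn (frontier K ∩ Metric.closedBall O r) C)
    (hOγ : O ∉ γ)
    (hmin : ∀ X ∈ γ, dist O C ≤ dist O X)
    (hCr : dist O C < r) :
    IsCriticalPoint K O C ∧ K ⊆ {X | 0 ≤ ⟪X - C, O - C⟫} := by
  have hCO : C ≠ O := fun h => hOγ (h ▸ hCγ)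
  have hCS : C ∈ frontier K ∩ Metric.closedBall O r :=
    connectedComponentIn_subset _ C (hγ ▸ hCγ)
  have hint : (interior K).Nonempty :=
    interior_nonempty_of_notMem_component hK.isClosed hKc hr.le hO hCS (hγ ▸ hOγ)
  have hfrK : frontier K ⊆ K := hK.isClosed.frontier_subset
  have hinterior : ∀ X ∈ interior K, 0 ≤ ⟪O - C, X - C⟫ := by
    intro X hX
    by_contra! hneg
    obtain ⟨T, hTS, hT, hCT, P, hPT, hP⟩ := exists_preconnected_subset_frontier_closer hKc
      (hfrK hO) (hfrK hCS.1) hCS.1 hCO hX hneg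
    have hTγ : T ⊆ γ := hγ ▸ hT.subset_connectedComponentIn hCT
      (hTS.trans (inter_subset_inter_right _ (Metric.closedBall_subset_closedBall hCr.le)))
    exact (hmin P (hTγ hPT)).not_gt hP
  have hsupp : ∀ X ∈ K, 0 ≤ ⟪O - C, X - C⟫ := by
    have hclosed : IsClosed {X : EuclideanSpace ℝ (Fin 2) | 0 ≤ ⟪O - C, X - C⟫} :=
      isClosed_le continuous_const (by fun_prop)
    have hsub := closure_minimal hinterior hclosed
    rw [hKc.closure_interior_eq_closure_of_nonempty_interior hint] at hsub
    exact fun X hX => hsub (subset_closure hX)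
  exact ⟨⟨hCS.1, hCO, hsupp⟩, fun X hX => by
    rw [mem_ofPred_eq, real_inner_comm]
    exact hsupp X hX⟩
end
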